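/- arXiv:math/0612409 — 2 statements merged into one kernel-verified Lean document; each statement's English description precedes it below -/
import Mathlib

section
/- For every integer g with 2 ≤ g ≤ 27 and every ν ∈ [0,1], one has max_{0 ≤ φ ≤ 2π} F_g(ν, φ) = F_g(ν, 0); consequently, for these g and ν, μ_g ≤ F_g(ν, 0). -/
open scoped Real

noncomputable section

/-- The surface relator `∏_{j=1}^g a_j b_j a_j⁻¹ b_j⁻¹` in the free group on the
`2g` generators `a_1, b_1, …, a_g, b_g`, where `(j, false)` stands for `a_j` and
`(j, true)` stands for `b_j`. -/
def surfaceRel (g : ℕ) : FreeGroup (Fin g × Bool) :=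
  ((List.finRange g).map fun j =>
    FreeGroup.of (j, false) * FreeGroup.of (j, true) *
      (FreeGroup.of (j, false))⁻¹ * (FreeGroup.of (j, true))⁻¹).prod

/-- The fundamental group `Γ_g` of the closed orientable surface of genus `g`:
the quotient of the free group on `a_1, b_1, …, a_g, b_g` by the normal closure
of `∏_{j=1}^g a_j b_j a_j⁻¹ b_j⁻¹`. -/
abbrev SurfaceGroup (g : ℕ) :=
  PresentedGroup ({surfaceRel g} : Set (FreeGroup (Fin g × Bool)))

/-- Enumeration of the `4g` elements `a_j, a_j⁻¹, b_j, b_j⁻¹` of `S_g`: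
`(j, w, i)` is `a_j` (if `w = false`) or `b_j` (if `w = true`), inverted when `i = true`. -/
def sgenFun (g : ℕ) (p : Fin g × Bool × Bool) : SurfaceGroup g :=
  if p.2.2 then (PresentedGroup.of (p.1, p.2.1))⁻¹ else PresentedGroup.of (p.1, p.2.1)

open scoped Classical in
/-- The symmetric generating set `S_g = {a_1^{±1}, b_1^{±1}, …, a_g^{±1}, b_g^{±1}}`
of `Γ_g`. -/
def Sgen (g : ℕ) : Finset (SurfaceGroup g) :=
  Finset.image (sgenFun g) Finset.univ

/-- `M` is the Markov operator of the simple random walk on `(Γ_g, S_g)`, i.e. the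
bounded operator on `ℓ²(Γ_g)` given by `(M f)(x) = (1/(4g)) ∑_{s ∈ S_g} f(xs)`;
`μ_g` is by definition its operator norm `‖M‖`. -/
def IsMarkov (g : ℕ)
    (M : lp (fun _ : SurfaceGroup g => ℂ) 2 →L[ℂ] lp (fun _ : SurfaceGroup g => ℂ) 2) :
    Prop :=
  ∀ (f : lp (fun _ : SurfaceGroup g => ℂ) 2) (x : SurfaceGroup g),
    M f x = (4 * (g : ℂ))⁻¹ * ∑ s ∈ Sgen g, f (x * s)

/-- The inverse hyperbolic cosine, `arcosh x = log (x + √(x² − 1))`. -/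
def arcosh (x : ℝ) : ℝ := Real.log (x + Real.sqrt (x ^ 2 - 1))

/-- `D_g = 2 arccosh (cot (π/(4g)))`, the hyperbolic distance between the centres of
two adjacent cells of the tesselation of `H²` by regular `4g`-gons. -/
def Dg (g : ℕ) : ℝ := 2 * arcosh (Real.tan (π / (4 * g)))⁻¹

/-- `b(ρ, φ) = 1/(cosh ρ − sinh ρ · cos φ)`. -/
def bker (ρ φ : ℝ) : ℝ := (Real.cosh ρ - Real.sinh ρ * Real.cos φ)⁻¹

/-- `F_g(ν, φ) = (1/(4g)) ∑_{j=0}^{4g−1} b(D_g, φ + j·2π/(4g))^ν`. -/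
def Fg (g : ℕ) (ν φ : ℝ) : ℝ :=
  (4 * (g : ℝ))⁻¹ *
    ∑ j ∈ Finset.range (4 * g), bker (Dg g) (φ + j * (2 * π / (4 * g))) ^ ν

lemma ring_choose_nonneg {ν : ℝ} (hν : 0 ≤ ν) (m : ℕ) : 0 ≤ Ring.choose (ν + m - 1) m := by
  have h : Ring.choose (ν + m - 1) m = Ring.multichoose ν m := by
    rw [Ring.choose]; congr 1; ring
  have h2 := Ring.factorial_nsmul_multichoose_eq_ascPochhammer ν m
  rw [Polynomial.ascPochhammer_smeval_eq_eval, nsmul_eq_mul] at h2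
  have h3 : 0 ≤ (ascPochhammer ℝ m).eval ν := by
    rcases hν.eq_or_lt with rfl | h0
    · rw [ascPochhammer_eval_zero]; split_ifs <;> norm_num
    · exact (ascPochhammer_pos m ν h0).le
  rw [h]
  rw [← h2] at h3
  exact nonneg_of_mul_nonneg_right h3 (by positivity)

lemma hasSum_one_sub_rpow_neg (ν : ℝ) {y : ℝ} (hy : |y| < 1) :
    HasSum (fun m : ℕ => Ring.choose (ν + m - 1) m * y ^ m) ((1 - y)⁻¹ ^ ν) := by
  have h := (Real.one_div_one_sub_rpow_hasFPowerSeriesOnBall_zero ν).hasSum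
    (y := y) (by simpa [enorm_eq_nnnorm, ← NNReal.coe_lt_coe] using hy)
  have h1 : 0 ≤ 1 - y := by linarith [(abs_lt.1 hy).2]
  simpa [FormalMultilinearSeries.ofScalars_apply_eq, mul_comm, Real.inv_rpow h1] using h

lemma sum_cos_rotation_le (n : ℕ) (hn : n ≠ 0) (l : ℤ) (φ : ℝ) :
    ∑ j ∈ Finset.range n, Real.cos (l * (φ + j * (2 * π / n))) ≤
      ∑ j ∈ Finset.range n, Real.cos (l * (j * (2 * π / n))) := by
  have hn' : (n : ℝ) ≠ 0 := by exact_mod_cast hn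
  set z : ℂ := Complex.exp ((l * (2 * π / n) : ℝ) * Complex.I) with hz
  have hzn : z ^ n = 1 := by
    rw [hz, ← Complex.exp_nat_mul, Complex.exp_eq_one_iff]
    refine ⟨l, ?_⟩
    have : (n : ℂ) ≠ 0 := by exact_mod_cast hn
    push_cast
    field_simp
  have hzj (j : ℕ) : z ^ j = Complex.exp ((l * (j * (2 * π / n)) : ℝ) * Complex.I) := by
    rw [hz, ← Complex.exp_nat_mul]
    congr 1
    push_cast
    ring
  have hcos (j : ℕ) (ψ : ℝ) : Real.cos (l * (ψ + j * (2 * π / n))) =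
      (Complex.exp ((l * ψ : ℝ) * Complex.I) * z ^ j).re := by
    rw [hzj, ← Complex.exp_add, ← Complex.exp_ofReal_mul_I_re]
    congr 2
    push_cast
    ring
  have hcos0 (j : ℕ) : Real.cos (l * (j * (2 * π / n))) = (z ^ j).re := by
    simpa using hcos j 0
  simp only [hcos, hcos0, ← Complex.re_sum, ← Finset.mul_sum]
  by_cases h1 : z = 1
  · simp only [h1, one_pow, Finset.sum_const, Finset.card_range, nsmul_eq_mul, mul_one,
      Complex.mul_re, Complex.natCast_re, Complex.natCast_im, mul_zero, sub_zero,
      Complex.exp_ofReal_mul_I_re]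
    simpa using
      mul_le_mul_of_nonneg_right (Real.cos_le_one (l * φ)) (Nat.cast_nonneg (α := ℝ) n)
  · simp [geom_sum_eq h1, hzn]

lemma sum_cos_pow_mul_cos_rotation_le (n : ℕ) (hn : n ≠ 0) (φ : ℝ) (m : ℕ) (l : ℤ) :
    ∑ j ∈ Finset.range n, Real.cos (φ + j * (2 * π / n)) ^ m *
        Real.cos (l * (φ + j * (2 * π / n))) ≤
      ∑ j ∈ Finset.range n, Real.cos (j * (2 * π / n)) ^ m *
        Real.cos (l * (j * (2 * π / n))) := by
  induction m generalizing l with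
  | zero => simpa using sum_cos_rotation_le n hn l φ
  | succ m ih =>
    have key (x : ℝ) : Real.cos x ^ (m + 1) * Real.cos (l * x) =
        (1 / 2) * (Real.cos x ^ m * Real.cos ((l + 1 : ℤ) * x)) +
          (1 / 2) * (Real.cos x ^ m * Real.cos ((l - 1 : ℤ) * x)) := by
      push_cast
      rw [add_mul, sub_mul, one_mul, Real.cos_add, Real.cos_sub]
      ring
    simp only [key, Finset.sum_add_distrib, ← Finset.mul_sum]
    linarith [ih (l + 1), ih (l - 1)]

lemma sum_cos_pow_rotation_le (n : ℕ) (hn : n ≠ 0) (φ : ℝ) (m : ℕ) :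
    ∑ j ∈ Finset.range n, Real.cos (φ + j * (2 * π / n)) ^ m ≤
      ∑ j ∈ Finset.range n, Real.cos (j * (2 * π / n)) ^ m := by
  simpa using sum_cos_pow_mul_cos_rotation_le n hn φ m 0

lemma hasSum_bker_rpow {ρ ν : ℝ} (x : ℝ) :
    HasSum (fun m : ℕ => (Real.cosh ρ)⁻¹ ^ ν * (Ring.choose (ν + m - 1) m * Real.tanh ρ ^ m) *
      Real.cos x ^ m) (bker ρ x ^ ν) := by
  have hc := Real.cosh_pos ρ
  have ht : |Real.tanh ρ| < 1 := Real.abs_tanh_lt_one ρ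
  have hy : |Real.tanh ρ * Real.cos x| < 1 := by
    rw [abs_mul]
    exact (mul_le_of_le_one_right (abs_nonneg _) (Real.abs_cos_le_one x)).trans_lt ht
  have h := (hasSum_one_sub_rpow_neg ν hy).mul_left ((Real.cosh ρ)⁻¹ ^ ν)
  have h1 : 0 ≤ (1 - Real.tanh ρ * Real.cos x)⁻¹ := by
    have := (abs_lt.1 hy).2
    exact inv_nonneg.2 (by linarith)
  have hb : bker ρ x = (Real.cosh ρ)⁻¹ * (1 - Real.tanh ρ * Real.cos x)⁻¹ := by
    rw [bker, ← mul_inv, Real.tanh_eq_sinh_div_cosh]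
    congr 1
    field_simp
  rw [hb, Real.mul_rpow (inv_nonneg.2 hc.le) h1]
  simpa only [mul_pow, mul_assoc] using h

lemma tan_pi_div_pos {g : ℕ} (hg : 2 ≤ g) : 0 < Real.tan (π / (4 * g)) := by
  have hg' : (2 : ℝ) ≤ g := by exact_mod_cast hg
  apply Real.tan_pos_of_pos_of_lt_pi_div_two (by positivity)
  rw [div_lt_div_iff₀ (by positivity) (by norm_num)]
  nlinarith [Real.pi_pos]

lemma one_le_inv_tan {g : ℕ} (hg : 2 ≤ g) : 1 ≤ (Real.tan (π / (4 * g)))⁻¹ := by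
  have hg' : (2 : ℝ) ≤ g := by exact_mod_cast hg
  rw [one_le_inv₀ (tan_pi_div_pos hg), ← Real.tan_pi_div_four]
  have hle : π / (4 * g) ≤ π / 4 := by gcongr; linarith
  refine Real.strictMonoOn_tan.monotoneOn ⟨?_, ?_⟩ ⟨?_, ?_⟩ hle
  · have : 0 < π / (4 * g) := by positivity
    linarith [Real.pi_pos]
  all_goals linarith [Real.pi_pos]

lemma cosh_half_Dg {g : ℕ} (hg : 2 ≤ g) :
    Real.cosh (Dg g / 2) = (Real.tan (π / (4 * g)))⁻¹ := by
  rw [Dg, mul_div_cancel_left₀ _ (two_ne_zero)]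
  exact Real.cosh_arcosh (one_le_inv_tan hg)

lemma Dg_nonneg {g : ℕ} (hg : 2 ≤ g) : 0 ≤ Dg g :=
  mul_nonneg zero_le_two (Real.arcosh_nonneg (one_le_inv_tan hg))

theorem Fg_le_Fg_zero {g : ℕ} (hg : 2 ≤ g) {ν : ℝ} (hν : 0 ≤ ν) (φ : ℝ) :
    Fg g ν φ ≤ Fg g ν 0 := by
  have ht : 0 ≤ Real.tanh (Dg g) := by
    rw [Real.tanh_eq_sinh_div_cosh]
    exact div_nonneg (Real.sinh_nonneg_iff.2 (Dg_nonneg hg)) (Real.cosh_pos _).le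
  have hs (ψ : ℝ) := hasSum_sum (s := Finset.range (4 * g)) fun j _ =>
    hasSum_bker_rpow (ρ := Dg g) (ν := ν) (ψ + j * (2 * π / (4 * g)))
  refine mul_le_mul_of_nonneg_left (hasSum_le (fun m => ?_) (hs φ) (hs 0)) (by positivity)
  simp only [← Finset.mul_sum, zero_add]
  refine mul_le_mul_of_nonneg_left ?_
    (mul_nonneg (Real.rpow_nonneg (inv_nonneg.2 (Real.cosh_pos _).le) _)
      (mul_nonneg (ring_choose_nonneg hν m) (pow_nonneg ht m)))
  simpa using sum_cos_pow_rotation_le (4 * g) (by omega) φ m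

section Schur

variable {G : Type*} [Group G]

lemma sum_sq_sum_mul_right_le (S : Finset G) (hS : ∀ s ∈ S, s⁻¹ ∈ S) {h : G → ℝ}
    (h_pos : ∀ x, 0 < h x) {C : ℝ} (hC : ∀ x, ∑ s ∈ S, h (x * s) ≤ C * h x)
    (F : G → ℝ) {B : ℝ} (hB : ∀ U : Finset G, ∑ x ∈ U, F x ^ 2 ≤ B) (T : Finset G) :
    ∑ x ∈ T, (∑ s ∈ S, F (x * s)) ^ 2 ≤ C ^ 2 * B := by
  classical
  have hC0 : 0 ≤ C :=
    nonneg_of_mul_nonneg_left ((Finset.sum_nonneg fun s _ => (h_pos _).le).trans (hC 1)) (h_pos 1)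
  set U : Finset G := S.biUnion fun s => T.image (· * s) with hU
  have h1 (x : G) : (∑ s ∈ S, F (x * s)) ^ 2 ≤
      C * ∑ s ∈ S, h x * (F (x * s) ^ 2 / h (x * s)) := by
    calc (∑ s ∈ S, F (x * s)) ^ 2
        ≤ (∑ s ∈ S, h (x * s)) * ∑ s ∈ S, F (x * s) ^ 2 / h (x * s) :=
          Finset.sum_sq_le_sum_mul_sum_of_sq_le_mul S (fun s _ => (h_pos _).le)
            (fun s _ => div_nonneg (sq_nonneg _) (h_pos _).le)
            (fun s _ => (mul_div_cancel₀ _ (h_pos _).ne').ge)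
      _ ≤ (C * h x) * ∑ s ∈ S, F (x * s) ^ 2 / h (x * s) :=
          mul_le_mul_of_nonneg_right (hC x)
            (Finset.sum_nonneg fun s _ => div_nonneg (sq_nonneg _) (h_pos _).le)
      _ = _ := by rw [← Finset.mul_sum, mul_assoc]
  have h2 (s : G) (hs : s ∈ S) : ∑ x ∈ T, h x * (F (x * s) ^ 2 / h (x * s)) ≤
      ∑ y ∈ U, h (y * s⁻¹) * (F y ^ 2 / h y) := by
    calc ∑ x ∈ T, h x * (F (x * s) ^ 2 / h (x * s))
        = ∑ y ∈ T.image (· * s), h (y * s⁻¹) * (F y ^ 2 / h y) := by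
          rw [Finset.sum_image fun x _ y _ hxy => mul_right_cancel hxy]
          simp
      _ ≤ _ := Finset.sum_le_sum_of_subset_of_nonneg
          (Finset.subset_biUnion_of_mem (fun s => T.image (· * s)) hs)
          fun y _ _ => mul_nonneg (h_pos _).le (div_nonneg (sq_nonneg _) (h_pos _).le)
  have h3 (y : G) : ∑ s ∈ S, h (y * s⁻¹) * (F y ^ 2 / h y) ≤ C * F y ^ 2 := by
    have hinv : ∑ s ∈ S, h (y * s⁻¹) = ∑ s ∈ S, h (y * s) :=
      Finset.sum_nbij' (·⁻¹) (·⁻¹) hS hS (by simp) (by simp) (by simp)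
    rw [← Finset.sum_mul, hinv]
    calc _ ≤ C * h y * (F y ^ 2 / h y) :=
          mul_le_mul_of_nonneg_right (hC y) (div_nonneg (sq_nonneg _) (h_pos _).le)
      _ = _ := by rw [mul_assoc, mul_div_cancel₀ _ (h_pos y).ne']
  calc ∑ x ∈ T, (∑ s ∈ S, F (x * s)) ^ 2
      ≤ ∑ x ∈ T, C * ∑ s ∈ S, h x * (F (x * s) ^ 2 / h (x * s)) :=
        Finset.sum_le_sum fun x _ => h1 x
    _ = C * ∑ s ∈ S, ∑ x ∈ T, h x * (F (x * s) ^ 2 / h (x * s)) := by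
        rw [← Finset.mul_sum, Finset.sum_comm]
    _ ≤ C * ∑ s ∈ S, ∑ y ∈ U, h (y * s⁻¹) * (F y ^ 2 / h y) :=
        mul_le_mul_of_nonneg_left (Finset.sum_le_sum h2) hC0
    _ = C * ∑ y ∈ U, ∑ s ∈ S, h (y * s⁻¹) * (F y ^ 2 / h y) := by rw [Finset.sum_comm]
    _ ≤ C * ∑ y ∈ U, C * F y ^ 2 :=
        mul_le_mul_of_nonneg_left (Finset.sum_le_sum fun y _ => h3 y) hC0
    _ = C ^ 2 * ∑ y ∈ U, F y ^ 2 := by rw [← Finset.mul_sum, sq, mul_assoc]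
    _ ≤ C ^ 2 * B := mul_le_mul_of_nonneg_left (hB U) (sq_nonneg C)

theorem opNorm_le_of_sum_mul_right_le (S : Finset G) (hS : ∀ s ∈ S, s⁻¹ ∈ S) {h : G → ℝ}
    (h_pos : ∀ x, 0 < h x) {C : ℝ} (hC : ∀ x, ∑ s ∈ S, h (x * s) ≤ C * h x) {k : ℝ} (hk : 0 ≤ k)
    (M : lp (fun _ : G => ℂ) 2 →L[ℂ] lp (fun _ : G => ℂ) 2)
    (hM : ∀ f x, M f x = k * ∑ s ∈ S, f (x * s)) : ‖M‖ ≤ k * C := by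
  have hC0 : 0 ≤ C :=
    nonneg_of_mul_nonneg_left ((Finset.sum_nonneg fun s _ => (h_pos _).le).trans (hC 1)) (h_pos 1)
  refine M.opNorm_le_bound (mul_nonneg hk hC0) fun f => ?_
  refine lp.norm_le_of_forall_sum_le (by simp)
    (mul_nonneg (mul_nonneg hk hC0) (norm_nonneg f)) fun T => ?_
  have hB (U : Finset G) : ∑ x ∈ U, ‖f x‖ ^ 2 ≤ ‖f‖ ^ 2 := by
    simpa using lp.sum_rpow_le_norm_rpow (p := 2) (by simp) f U
  have key := sum_sq_sum_mul_right_le S hS h_pos hC (fun x => ‖f x‖) hB T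
  simp only [ENNReal.toReal_ofNat, Real.rpow_ofNat]
  calc ∑ x ∈ T, ‖M f x‖ ^ 2 ≤ ∑ x ∈ T, k ^ 2 * (∑ s ∈ S, ‖f (x * s)‖) ^ 2 := by
        refine Finset.sum_le_sum fun x _ => ?_
        rw [hM, norm_mul, mul_pow, Complex.norm_real, Real.norm_of_nonneg hk]
        gcongr
        exact norm_sum_le _ _
    _ ≤ k ^ 2 * (C ^ 2 * ‖f‖ ^ 2) := by
        rw [← Finset.mul_sum]
        exact mul_le_mul_of_nonneg_left key (sq_nonneg k)
    _ = (k * C * ‖f‖) ^ 2 := by ring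

end Schur

open Matrix in
/-- Rotation of the plane by the angle `φ`. -/
def rot (φ : ℝ) : SpecialLinearGroup (Fin 2) ℝ :=
  ⟨!![Real.cos φ, -Real.sin φ; Real.sin φ, Real.cos φ], by
    rw [det_fin_two_of]; linarith [Real.sin_sq_add_cos_sq φ]⟩

open Matrix in
/-- The element of `SL₂(ℝ)` acting on the hyperbolic plane as the half-turn about the point at
distance `ρ / 2` from the base point. -/
def halfTurn (ρ : ℝ) : SpecialLinearGroup (Fin 2) ℝ :=
  ⟨!![0, -Real.exp (ρ / 2); Real.exp (-(ρ / 2)), 0], by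
    rw [det_fin_two_of]; simp [← Real.exp_add]⟩

lemma coe_rot (φ : ℝ) : (rot φ : Matrix (Fin 2) (Fin 2) ℝ) =
    !![Real.cos φ, -Real.sin φ; Real.sin φ, Real.cos φ] := rfl

lemma coe_halfTurn (ρ : ℝ) : (halfTurn ρ : Matrix (Fin 2) (Fin 2) ℝ) =
    !![0, -Real.exp (ρ / 2); Real.exp (-(ρ / 2)), 0] := rfl

lemma rot_zero : rot 0 = 1 := by
  apply Subtype.ext
  rw [coe_rot, Matrix.SpecialLinearGroup.coe_one, Matrix.one_fin_two]
  simp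

lemma rot_add (φ ψ : ℝ) : rot (φ + ψ) = rot φ * rot ψ := by
  apply Subtype.ext
  rw [Matrix.SpecialLinearGroup.coe_mul, coe_rot, coe_rot, coe_rot, Matrix.mul_fin_two,
    Real.cos_add, Real.sin_add]
  congr! 3 <;> ring_nf

lemma rot_pow (φ : ℝ) (k : ℕ) : rot φ ^ k = rot (k * φ) := by
  induction k with
  | zero => simp [rot_zero]
  | succ k ih => rw [pow_succ, ih, ← rot_add]; congr 1; push_cast; ring

lemma rot_inv (φ : ℝ) : (rot φ)⁻¹ = rot (-φ) := by
  rw [inv_eq_iff_mul_eq_one, ← rot_add, add_neg_cancel, rot_zero]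

lemma rot_add_pi (φ : ℝ) : rot (φ + π) = -rot φ := by
  apply Subtype.ext
  rw [Matrix.SpecialLinearGroup.coe_neg, coe_rot, coe_rot, Real.cos_add_pi, Real.sin_add_pi]
  simp

lemma halfTurn_inv (ρ : ℝ) : (halfTurn ρ)⁻¹ = -halfTurn ρ := by
  rw [inv_eq_iff_mul_eq_one]
  apply Subtype.ext
  rw [Matrix.SpecialLinearGroup.coe_mul, Matrix.SpecialLinearGroup.coe_neg, coe_halfTurn,
    mul_neg, Matrix.mul_fin_two, Matrix.SpecialLinearGroup.coe_one, Matrix.one_fin_two]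
  simp [← Real.exp_add]

lemma sin_smul_pow (A : Matrix (Fin 2) (Fin 2) ℝ) (φ : ℝ) (hdet : A.det = 1)
    (htr : A.trace = 2 * Real.cos φ) (k : ℕ) :
    Real.sin φ • A ^ k = Real.sin (k * φ) • A - Real.sin ((k - 1) * φ) • 1 := by
  have hsq : A * A = (2 * Real.cos φ) • A - 1 := by
    rw [Matrix.det_fin_two] at hdet
    rw [Matrix.trace_fin_two] at htr
    ext i j
    fin_cases i <;> fin_cases j <;> simp [Matrix.mul_apply, Fin.sum_univ_two, ← htr] <;>
      first | ring1 | linear_combination -hdet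
  induction k with
  | zero => simp
  | succ k ih =>
    rw [pow_succ, ← smul_mul_assoc, ih, sub_mul, smul_mul_assoc, hsq, smul_mul_assoc, one_mul,
      smul_sub, smul_smul]
    have h1 : Real.sin ((k + 1 : ℕ) * φ) =
        Real.sin (k * φ) * (2 * Real.cos φ) - Real.sin ((k - 1) * φ) := by
      push_cast
      rw [add_mul, sub_mul, one_mul, Real.sin_add, Real.sin_sub]; ring
    rw [h1, sub_smul, show ((k + 1 : ℕ) : ℝ) - 1 = k by push_cast; ring]
    abel

lemma halfTurn_mul_rot_pow {g : ℕ} (hg : 2 ≤ g) :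
    (halfTurn (Dg g) * rot (π / (4 * g))) ^ (4 * g) = -1 := by
  have hg0 : (g : ℝ) ≠ 0 := by positivity
  set φ : ℝ := π - π / (4 * g) with hφ
  have hlt : π / (4 * g) < π := by
    have : (2 : ℝ) ≤ g := by exact_mod_cast hg
    rw [div_lt_iff₀ (by positivity)]
    nlinarith [Real.pi_pos]
  have hs : 0 < Real.sin (π / (4 * g)) := Real.sin_pos_of_pos_of_lt_pi (by positivity) hlt
  have hsin : Real.sin φ ≠ 0 := by
    rw [hφ, Real.sin_pi_sub]
    exact hs.ne'
  have hper (x : ℝ) : Real.sin ((4 * g : ℕ) * π - x) = -Real.sin x := by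
    rw [show ((4 * g : ℕ) : ℝ) * π - x = -x + (2 * g : ℕ) * (2 * π) by push_cast; ring,
      Real.sin_add_nat_mul_two_pi, Real.sin_neg]
  have h := sin_smul_pow
    (halfTurn (Dg g) * rot (π / (4 * g)) : Matrix.SpecialLinearGroup (Fin 2) ℝ).1 φ
    (Matrix.SpecialLinearGroup.det_coe _) ?_ (4 * g)
  · have h1 : ((4 * g : ℕ) : ℝ) * φ = (4 * g : ℕ) * π - π := by
      rw [hφ]; push_cast; field_simp
    have h2 : (((4 * g : ℕ) : ℝ) - 1) * φ = (4 * g : ℕ) * π - (π + φ) := by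
      rw [sub_mul, h1]; ring
    have h3 : Real.sin ((4 * g : ℕ) * π - (π + φ)) = Real.sin φ := by
      rw [hper, add_comm, Real.sin_add_pi, neg_neg]
    have h4 : Real.sin ((4 * g : ℕ) * π - π) = 0 := by
      rw [hper, Real.sin_pi, neg_zero]
    rw [h1, h2, h3, h4, zero_smul, zero_sub, ← smul_neg] at h
    exact Subtype.ext (smul_right_injective _ hsin h)
  · have hc := cosh_half_Dg hg
    rw [Real.cosh_eq, Real.tan_eq_sin_div_cos, inv_div, eq_div_iff hs.ne'] at hc
    rw [Matrix.SpecialLinearGroup.coe_mul, coe_rot, coe_halfTurn, Matrix.mul_fin_two,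
      Matrix.trace_fin_two_of, hφ, Real.cos_pi_sub]
    linear_combination -2 * hc

lemma commutator_rot_halfTurn {G : Type*} [Group G] [HasDistribNeg G] {r σ : G} (hσ : σ⁻¹ = -σ)
    (u : G) :
    (u * σ * (u * r ^ 2)⁻¹) * (u * r ^ 3 * σ * (u * r)⁻¹) * (u * σ * (u * r ^ 2)⁻¹)⁻¹ *
      (u * r ^ 3 * σ * (u * r)⁻¹)⁻¹ = u * (σ * r) ^ 4 * (u * r ^ 4)⁻¹ := by
  calc _ = u * (σ * r * σ * r * σ⁻¹ * r * σ⁻¹ * r) * (u * r ^ 4)⁻¹ := by group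
    _ = _ := by
      rw [hσ]
      simp only [mul_neg, neg_mul, neg_neg, pow_succ, pow_zero, one_mul, mul_assoc]

lemma prod_range_telescope {G : Type*} [Group G] (r c : G) (k : ℕ) :
    ((List.range k).map fun j => r ^ (4 * j) * c * (r ^ (4 * j) * r ^ 4)⁻¹).prod =
      c ^ k * (r ^ (4 * k))⁻¹ := by
  induction k with
  | zero => simp
  | succ k ih =>
    rw [List.range_succ, List.map_append, List.prod_append, ih, mul_add, pow_add r, pow_succ c]
    simp [mul_assoc]

/-- The images of `a_j` and `b_j` under the Fuchsian representation of `Γ_g`. -/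
def fuchsianGen (g : ℕ) (p : Fin g × Bool) : Matrix.SpecialLinearGroup (Fin 2) ℝ :=
  let r := rot (π / (4 * g))
  let u := r ^ (4 * (p.1 : ℕ))
  if p.2 then u * r ^ 3 * halfTurn (Dg g) * (u * r)⁻¹ else u * halfTurn (Dg g) * (u * r ^ 2)⁻¹

lemma lift_surfaceRel {g : ℕ} (hg : 2 ≤ g) :
    FreeGroup.lift (fuchsianGen g) (surfaceRel g) = 1 := by
  have hg0 : (g : ℝ) ≠ 0 := by positivity
  have hrot : rot (π / (4 * g)) ^ (4 * g) = -1 := by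
    rw [rot_pow, show ((4 * g : ℕ) : ℝ) * (π / (4 * g)) = π by push_cast; field_simp]
    apply Subtype.ext
    rw [coe_rot, Matrix.SpecialLinearGroup.coe_neg, Matrix.SpecialLinearGroup.coe_one,
      Matrix.one_fin_two]
    simp
  have key := prod_range_telescope (rot (π / (4 * g))) ((halfTurn (Dg g) * rot (π / (4 * g))) ^ 4) g
  rw [← pow_mul, halfTurn_mul_rot_pow hg, hrot] at key
  rw [surfaceRel, map_list_prod, List.map_map,
    ← mul_inv_cancel (-1 : Matrix.SpecialLinearGroup (Fin 2) ℝ), ← key,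
    ← List.map_coe_finRange_eq_range, List.map_map]
  congr 2
  funext j
  simp only [Function.comp_apply, map_mul, map_inv, FreeGroup.lift_apply_of, fuchsianGen, if_true,
    Bool.false_eq_true, if_false]
  exact commutator_rot_halfTurn (halfTurn_inv _) _

/-- The Fuchsian representation of the surface group. -/
def fuchsian {g : ℕ} (hg : 2 ≤ g) : SurfaceGroup g →* Matrix.SpecialLinearGroup (Fin 2) ℝ :=
  PresentedGroup.toGroup (f := fuchsianGen g) (by simpa using lift_surfaceRel hg)

/-- The function `A ↦ ‖A⁻¹ e₁‖²` on `SL₂(ℝ)`, where `e₁ = (1, 0)`. -/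
def invNormSq (A : Matrix.SpecialLinearGroup (Fin 2) ℝ) : ℝ :=
  (A⁻¹).1 0 0 ^ 2 + (A⁻¹).1 1 0 ^ 2

lemma invNormSq_pos (A : Matrix.SpecialLinearGroup (Fin 2) ℝ) : 0 < invNormSq A := by
  have h := Matrix.SpecialLinearGroup.det_coe A⁻¹
  rw [Matrix.det_fin_two] at h
  rw [invNormSq]
  by_contra hn
  have h0 : (A⁻¹).1 0 0 = 0 := by nlinarith [sq_nonneg ((A⁻¹).1 0 0), sq_nonneg ((A⁻¹).1 1 0)]
  have h1 : (A⁻¹).1 1 0 = 0 := by nlinarith [sq_nonneg ((A⁻¹).1 0 0), sq_nonneg ((A⁻¹).1 1 0)]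
  simp [h0, h1] at h

lemma exists_invNormSq_mul (A : Matrix.SpecialLinearGroup (Fin 2) ℝ) :
    ∃ t : ℝ, ∀ ρ a b : ℝ, invNormSq (A * (rot a * halfTurn ρ * rot b)) =
      invNormSq A * (Real.cosh ρ - Real.sinh ρ * Real.cos (2 * (t - a))) := by
  obtain ⟨r, t, h0, h1⟩ : ∃ r t : ℝ,
      (A⁻¹).1 0 0 = r * Real.cos t ∧ (A⁻¹).1 1 0 = r * Real.sin t :=
    let z : ℂ := ⟨(A⁻¹).1 0 0, (A⁻¹).1 1 0⟩
    ⟨‖z‖, z.arg, (Complex.norm_mul_cos_arg z).symm, (Complex.norm_mul_sin_arg z).symm⟩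
  refine ⟨t, fun ρ a b => ?_⟩
  have hinv : (A * (rot a * halfTurn ρ * rot b))⁻¹ =
      rot (-b) * (-halfTurn ρ * (rot (-a) * A⁻¹)) := by
    simp only [mul_inv_rev, rot_inv, halfTurn_inv, mul_assoc]
  have hc := Real.sin_sq_add_cos_sq b
  have he : Real.exp (ρ / 2) ^ 2 = Real.cosh ρ + Real.sinh ρ := by
    rw [← Real.exp_nat_mul, Real.cosh_add_sinh]; congr 1; push_cast; ring
  have he' : Real.exp (-(ρ / 2)) ^ 2 = Real.cosh ρ - Real.sinh ρ := by
    rw [← Real.exp_nat_mul, Real.cosh_sub_sinh]; congr 1; push_cast; ring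
  have hrot : (rot (-a) * A⁻¹).1 0 0 = r * Real.cos (t - a) ∧
      (rot (-a) * A⁻¹).1 1 0 = r * Real.sin (t - a) := by
    constructor
    · rw [Matrix.SpecialLinearGroup.coe_mul, Matrix.mul_apply, Fin.sum_univ_two, h0, h1, coe_rot,
        Real.cos_sub]
      simp
      ring
    · rw [Matrix.SpecialLinearGroup.coe_mul, Matrix.mul_apply, Fin.sum_univ_two, h0, h1, coe_rot,
        Real.sin_sub]
      simp
      ring
  have hnorm : invNormSq A = r ^ 2 := by
    rw [invNormSq, h0, h1]
    linear_combination r ^ 2 * Real.sin_sq_add_cos_sq t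
  rw [hnorm, invNormSq, hinv]
  set W := rot (-a) * A⁻¹
  have e0 : (rot (-b) * (-halfTurn ρ * W)).1 0 0 =
      Real.cos b * (Real.exp (ρ / 2) * W.1 1 0) - Real.sin b * (Real.exp (-(ρ / 2)) * W.1 0 0) := by
    simp only [Matrix.SpecialLinearGroup.coe_mul, Matrix.SpecialLinearGroup.coe_neg,
      Matrix.mul_apply, Fin.sum_univ_two, coe_rot, coe_halfTurn]
    simp
    ring
  have e1 : (rot (-b) * (-halfTurn ρ * W)).1 1 0 =
      -Real.sin b * (Real.exp (ρ / 2) * W.1 1 0) -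
        Real.cos b * (Real.exp (-(ρ / 2)) * W.1 0 0) := by
    simp only [Matrix.SpecialLinearGroup.coe_mul, Matrix.SpecialLinearGroup.coe_neg,
      Matrix.mul_apply, Fin.sum_univ_two, coe_rot, coe_halfTurn]
    simp
    ring
  rw [e0, e1, hrot.1, hrot.2, Real.cos_two_mul]
  set c := Real.cos (t - a)
  set s := Real.sin (t - a)
  have hcs : s ^ 2 + c ^ 2 = 1 := Real.sin_sq_add_cos_sq _
  calc _ = (Real.sin b ^ 2 + Real.cos b ^ 2) * r ^ 2 *
        (Real.exp (ρ / 2) ^ 2 * s ^ 2 + Real.exp (-(ρ / 2)) ^ 2 * c ^ 2) := by ring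
    _ = _ := by
      rw [hc, he, he']
      linear_combination r ^ 2 * (Real.cosh ρ + Real.sinh ρ) * hcs

lemma sgenFun_inv (g : ℕ) (j : Fin g) (w i : Bool) :
    (sgenFun g (j, w, i))⁻¹ = sgenFun g (j, w, !i) := by
  cases i <;> simp [sgenFun]

lemma inv_mem_Sgen (g : ℕ) : ∀ s ∈ Sgen g, s⁻¹ ∈ Sgen g := by
  classical
  intro s hs
  obtain ⟨⟨j, w, i⟩, -, rfl⟩ := Finset.mem_image.1 hs
  rw [sgenFun_inv]
  exact Finset.mem_image_of_mem _ (Finset.mem_univ _)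

/-- The index of the side of the `4g`-gon across which a generator moves the base cell. -/
def sideIndex (w i : Bool) : Fin 4 :=
  match w, i with
  | false, false => 0
  | true, true => 1
  | false, true => 2
  | true, false => 3

lemma fuchsian_sgenFun {g : ℕ} (hg : 2 ≤ g) (j : Fin g) (w i : Bool) :
    ∃ b, fuchsian hg (sgenFun g (j, w, i)) =
      rot (((sideIndex w i + 4 * j : ℕ) : ℝ) * (π / (4 * g))) * halfTurn (Dg g) * rot b := by
  have hof (p : Fin g × Bool) : fuchsian hg (PresentedGroup.of p) = fuchsianGen g p :=
    PresentedGroup.toGroup.of _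
  set r := rot (π / (4 * g)) with hr
  have hdir (p q : ℕ) : r ^ p * halfTurn (Dg g) * (r ^ q)⁻¹ =
      r ^ p * halfTurn (Dg g) * rot (-(q * (π / (4 * g)))) := by
    rw [hr, rot_pow _ q, rot_inv]
  have hinv (p q : ℕ) : (r ^ p * halfTurn (Dg g) * (r ^ q)⁻¹)⁻¹ =
      r ^ q * halfTurn (Dg g) * rot (-(p * (π / (4 * g))) + π) := by
    rw [mul_inv_rev, mul_inv_rev, inv_inv, halfTurn_inv, hr, rot_pow _ p, rot_inv, rot_add_pi,
      mul_neg, neg_mul, mul_neg, mul_assoc]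
  simp only [← rot_pow]
  cases w <;> cases i <;>
    simp only [sgenFun, sideIndex, if_true, if_false, Bool.false_eq_true, map_inv, hof, fuchsianGen,
      ← hr, ← pow_add, ← pow_succ]
  · exact ⟨_, by simpa using hdir (4 * j) (4 * j + 2)⟩
  · exact ⟨_, by simpa [add_comm] using hinv (4 * j) (4 * j + 2)⟩
  · exact ⟨_, by simpa [add_comm] using hdir (4 * j + 3) (4 * j + 1)⟩
  · exact ⟨_, by simpa [add_comm] using hinv (4 * j + 3) (4 * j + 1)⟩

lemma sum_sgenFun (g : ℕ) (f : ℕ → ℝ) :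
    ∑ p : Fin g × Bool × Bool, f (sideIndex p.2.1 p.2.2 + 4 * p.1) =
      ∑ k ∈ Finset.range (4 * g), f k := by
  rw [Fintype.sum_prod_type, mul_comm 4 g, ← Fin.sum_univ_eq_sum_range,
    ← finProdFinEquiv.sum_comp, Fintype.sum_prod_type]
  refine Finset.sum_congr rfl fun j _ => ?_
  simp [Fintype.sum_prod_type, Fin.sum_univ_four, sideIndex]
  ring

theorem sum_Sgen_le {g : ℕ} (hg : 2 ≤ g) {ν : ℝ} (hν : 0 ≤ ν) (x : SurfaceGroup g) :
    ∑ s ∈ Sgen g, (invNormSq (fuchsian hg (x * s)))⁻¹ ^ ν ≤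
      (4 * g * Fg g ν 0) * (invNormSq (fuchsian hg x))⁻¹ ^ ν := by
  classical
  have hg0 : (g : ℝ) ≠ 0 := by positivity
  obtain ⟨t, ht⟩ := exists_invNormSq_mul (fuchsian hg x)
  have hpos (y : SurfaceGroup g) : 0 ≤ (invNormSq (fuchsian hg y))⁻¹ :=
    (inv_pos.2 (invNormSq_pos _)).le
  have hterm (p : Fin g × Bool × Bool) : (invNormSq (fuchsian hg (x * sgenFun g p)))⁻¹ ^ ν =
      (invNormSq (fuchsian hg x))⁻¹ ^ ν * bker (Dg g)
        (-(2 * t) + (sideIndex p.2.1 p.2.2 + 4 * p.1 : ℕ) * (2 * π / (4 * g))) ^ ν := by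
    obtain ⟨j, w, i⟩ := p
    obtain ⟨b, hb⟩ := fuchsian_sgenFun hg j w i
    have h := ht (Dg g) (((sideIndex w i + 4 * j : ℕ) : ℝ) * (π / (4 * g))) b
    have hcos : Real.cos (2 * (t - ((sideIndex w i + 4 * j : ℕ) : ℝ) * (π / (4 * g)))) =
        Real.cos (-(2 * t) + (sideIndex w i + 4 * j : ℕ) * (2 * π / (4 * g))) := by
      rw [← Real.cos_neg]; congr 1; ring
    rw [hcos, ← hb, ← map_mul] at h
    have hfac : 0 < Real.cosh (Dg g) - Real.sinh (Dg g) *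
        Real.cos (-(2 * t) + (sideIndex w i + 4 * j : ℕ) * (2 * π / (4 * g))) :=
      pos_of_mul_pos_right (h ▸ invNormSq_pos _) (invNormSq_pos _).le
    rw [h, mul_inv, Real.mul_rpow (hpos x) (inv_nonneg.2 hfac.le), bker]
  calc ∑ s ∈ Sgen g, (invNormSq (fuchsian hg (x * s)))⁻¹ ^ ν
      ≤ ∑ p, (invNormSq (fuchsian hg (x * sgenFun g p)))⁻¹ ^ ν :=
        Finset.sum_image_le_of_nonneg (f := fun s => (invNormSq (fuchsian hg (x * s)))⁻¹ ^ ν)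
          fun s _ => Real.rpow_nonneg (hpos _) _
    _ = (invNormSq (fuchsian hg x))⁻¹ ^ ν * (4 * g * Fg g ν (-(2 * t))) := by
        simp only [hterm]
        rw [← Finset.mul_sum, sum_sgenFun g fun k =>
          bker (Dg g) (-(2 * t) + k * (2 * π / (4 * g))) ^ ν,
          Fg, mul_inv_cancel_left₀ (by positivity)]
    _ ≤ _ := by
        rw [mul_comm]
        gcongr
        · exact Real.rpow_nonneg (hpos x) _
        · exact Fg_le_Fg_zero hg hν _

/-- Lemma 2: for `2 ≤ g ≤ 27` and `ν ∈ [0,1]`, the maximum of `φ ↦ F_g(ν, φ)` over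
`[0, 2π]` is attained at `φ = 0`; consequently `μ_g ≤ F_g(ν, 0)` for these `g`, `ν`. -/
theorem max_Fg_eq_Fg_zero (g : ℕ) (hg : 2 ≤ g) (hg' : g ≤ 27)
    (ν : ℝ) (hν : ν ∈ Set.Icc (0 : ℝ) 1) :
    sSup (Fg g ν '' Set.Icc 0 (2 * π)) = Fg g ν 0 ∧
      ∀ M : lp (fun _ : SurfaceGroup g => ℂ) 2 →L[ℂ] lp (fun _ : SurfaceGroup g => ℂ) 2,
        IsMarkov g M → ‖M‖ ≤ Fg g ν 0 := by
  have hF := Fg_le_Fg_zero hg hν.1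
  refine ⟨?_, fun M hM => ?_⟩
  · refine IsGreatest.csSup_eq ⟨⟨0, ⟨le_rfl, by positivity⟩, rfl⟩, ?_⟩
    rintro _ ⟨φ, -, rfl⟩
    exact hF φ
  · have hg0 : (4 * g : ℝ) ≠ 0 := by positivity
    have h := opNorm_le_of_sum_mul_right_le (Sgen g) (inv_mem_Sgen g)
      (h := fun x => (invNormSq (fuchsian hg x))⁻¹ ^ ν)
      (fun x => Real.rpow_pos_of_pos (inv_pos.2 (invNormSq_pos _)) _)
      (sum_Sgen_le hg hν.1) (k := (4 * (g : ℝ))⁻¹) (by positivity) M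
      (fun f x => by rw [hM f x]; push_cast; rfl)
    rwa [inv_mul_cancel_left₀ hg0] at h
end
end

section
/- One has μ_2 ≤ 0.784. -/
open scoped Real

noncomputable section

open scoped Classical in
/-- **Schur test** for a symmetric family of right translations of a group: if `F` is a positive
function with `∑ p, F (x * u p) ≤ c * F x`, then convolution by the family has `ℓ²`-norm at
most `c`. -/
theorem sum_sq_sum_mul_right_le_s4 {G ι : Type*} [Group G] [Fintype ι] (u : ι → G) (e : ι ≃ ι)
    (he : ∀ p, u (e p) = (u p)⁻¹) {F : G → ℝ} (hF : ∀ x, 0 < F x) {c : ℝ} (hc : 0 ≤ c)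
    (hFc : ∀ x, ∑ p, F (x * u p) ≤ c * F x) {h : G → ℝ} {B : ℝ}
    (hB : ∀ T : Finset G, ∑ x ∈ T, h x ^ 2 ≤ B) (T : Finset G) :
    ∑ x ∈ T, (∑ p, h (x * u p)) ^ 2 ≤ c ^ 2 * B := by
  set T' : Finset G := Finset.univ.biUnion fun p => T.image (· * u p)
  calc ∑ x ∈ T, (∑ p, h (x * u p)) ^ 2
      ≤ ∑ x ∈ T, c * ∑ p, h (x * u p) ^ 2 * (F x / F (x * u p)) := by
        refine Finset.sum_le_sum fun x _ => ?_
        have key : (∑ p, h (x * u p)) ^ 2 ≤ (∑ p, F (x * u p) / F x) *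
            ∑ p, h (x * u p) ^ 2 * (F x / F (x * u p)) := by
          refine Finset.sum_sq_le_sum_mul_sum_of_sq_le_mul _
            (fun p _ => (div_pos (hF _) (hF _)).le)
            (fun p _ => mul_nonneg (sq_nonneg _) (div_pos (hF _) (hF _)).le) fun p _ => ?_
          have h₁ := (hF x).ne'
          have h₂ := (hF (x * u p)).ne'
          exact le_of_eq (by field_simp)
        refine key.trans (mul_le_mul_of_nonneg_right ?_ (Finset.sum_nonneg fun p _ =>
          mul_nonneg (sq_nonneg _) (div_pos (hF _) (hF _)).le))
        rw [← Finset.sum_div, div_le_iff₀ (hF x)]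
        exact hFc x
    _ = c * ∑ p, ∑ x ∈ T, h (x * u p) ^ 2 * (F x / F (x * u p)) := by
        rw [← Finset.mul_sum, Finset.sum_comm]
    _ ≤ c * ∑ p, ∑ y ∈ T', h y ^ 2 * (F (y * (u p)⁻¹) / F y) := by
        gcongr with p
        have himage := Finset.sum_image (s := T) (g := (· * u p))
          (f := fun y => h y ^ 2 * (F (y * (u p)⁻¹) / F y)) (mul_left_injective _).injOn
        simp only [mul_inv_cancel_right] at himage
        rw [← himage]
        refine Finset.sum_le_sum_of_subset_of_nonneg
          (Finset.subset_biUnion_of_mem (fun p => T.image (· * u p)) (Finset.mem_univ p))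
          fun y _ _ => mul_nonneg (sq_nonneg _) (div_pos (hF _) (hF _)).le
    _ = c * ∑ y ∈ T', h y ^ 2 * ((∑ p, F (y * u p)) / F y) := by
        rw [Finset.sum_comm]
        congr 1
        refine Finset.sum_congr rfl fun y _ => ?_
        rw [← Finset.mul_sum, ← Finset.sum_div, ← e.sum_comp (fun p => F (y * u p))]
        simp only [he]
    _ ≤ c * ∑ y ∈ T', h y ^ 2 * c := by
        gcongr with y
        rw [div_le_iff₀ (hF y)]
        exact hFc y
    _ = c ^ 2 * ∑ y ∈ T', h y ^ 2 := by
        rw [← Finset.sum_mul]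
        ring
    _ ≤ c ^ 2 * B := by
        gcongr
        exact hB T'

/-- A positive function on `ℤ²` that decays exponentially off the origin. -/
def latticeWeight (z : ℤ × ℤ) : ℝ :=
  if z = 0 then 1 else 2 / 3 * ((3 / 4) ^ z.1.natAbs * (3 / 4) ^ z.2.natAbs)

theorem latticeWeight_pos (z : ℤ × ℤ) : 0 < latticeWeight z := by
  unfold latticeWeight
  split_ifs <;> positivity

@[simp]
theorem latticeWeight_zero : latticeWeight 0 = 1 := if_pos rfl

theorem pow_natAbs_add_pow_natAbs_le (a : ℤ) :
    (3 / 4 : ℝ) ^ (a + 1).natAbs + (3 / 4) ^ (a - 1).natAbs ≤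
      25 / 12 * (3 / 4) ^ a.natAbs := by
  rcases lt_trichotomy a 0 with ha | rfl | ha
  · obtain ⟨n, rfl⟩ : ∃ n : ℕ, a = -(n + 1) := ⟨(-a - 1).toNat, by omega⟩
    rw [show (-((n : ℤ) + 1) + 1).natAbs = n by omega,
      show (-((n : ℤ) + 1) - 1).natAbs = n + 2 by omega,
      show (-((n : ℤ) + 1)).natAbs = n + 1 by omega]
    exact le_of_eq (by ring)
  · norm_num
  · obtain ⟨n, rfl⟩ : ∃ n : ℕ, a = n + 1 := ⟨(a - 1).toNat, by omega⟩
    rw [show ((n : ℤ) + 1 + 1).natAbs = n + 2 by omega,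
      show ((n : ℤ) + 1 - 1).natAbs = n by omega,
      show ((n : ℤ) + 1).natAbs = n + 1 by omega]
    exact le_of_eq (by ring)

/-- The sum of `latticeWeight` over the neighbours of a point of the standard lattice graph. -/
def neighborSum (z : ℤ × ℤ) : ℝ :=
  latticeWeight (z + (1, 0)) + latticeWeight (z - (1, 0)) +
    (latticeWeight (z + (0, 1)) + latticeWeight (z - (0, 1)))

theorem neighborSum_zero : neighborSum 0 = 2 := by
  norm_num [neighborSum, latticeWeight]

theorem neighborSum_le {z : ℤ × ℤ} (hz : z ≠ 0) :
    neighborSum z ≤ 17 / 4 * latticeWeight z := by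
  by_cases h : z + (1, 0) = 0 ∨ z - (1, 0) = 0 ∨ z + (0, 1) = 0 ∨ z - (0, 1) = 0
  · simp only [add_eq_zero_iff_eq_neg, sub_eq_zero] at h
    rcases h with rfl | rfl | rfl | rfl <;> norm_num [neighborSum, latticeWeight]
  · push Not at h
    obtain ⟨h₁, h₂, h₃, h₄⟩ := h
    obtain ⟨a, b⟩ := z
    simp only [neighborSum, latticeWeight, if_neg hz, if_neg h₁, if_neg h₂, if_neg h₃, if_neg h₄]
    simp only [Prod.mk_add_mk, Prod.mk_sub_mk, add_zero, sub_zero]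
    have ha := mul_le_mul_of_nonneg_right (pow_natAbs_add_pow_natAbs_le a)
      (by positivity : (0 : ℝ) ≤ (3 / 4) ^ b.natAbs)
    have hb := mul_le_mul_of_nonneg_right (pow_natAbs_add_pow_natAbs_le b)
      (by positivity : (0 : ℝ) ≤ (3 / 4) ^ a.natAbs)
    have hp : (0 : ℝ) ≤ (3 / 4) ^ a.natAbs * (3 / 4) ^ b.natAbs := by positivity
    linarith

/-- The two free factors `ℤ²` of the quotient `ℤ² * ℤ²` of the genus two surface group. -/
abbrev LatticeFactor (_ : Fin 2) := Multiplicative (ℤ × ℤ)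

open Monoid Monoid.CoprodI

/-- The product of the lattice weights of the letters of a reduced word. -/
def wordWeight (w : Word LatticeFactor) : ℝ :=
  (w.toList.map fun l => latticeWeight l.2.toAdd).prod

theorem wordWeight_pos (w : Word LatticeFactor) : 0 < wordWeight w :=
  List.prod_pos fun _ hx => by
    obtain ⟨l, -, rfl⟩ := List.mem_map.mp hx
    exact latticeWeight_pos _

theorem wordWeight_rcons {i : Fin 2} (p : Word.Pair LatticeFactor i) :
    wordWeight (Word.rcons p) = latticeWeight p.head.toAdd * wordWeight p.tail := by
  unfold Word.rcons
  split_ifs with h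
  · simp [h]
  · simp [wordWeight, Word.cons]

theorem wordWeight_of_smul {i : Fin 2} (m : LatticeFactor i) (w : Word LatticeFactor) :
    wordWeight (of m • w) = latticeWeight (m.toAdd + (Word.equivPair i w).head.toAdd) *
      wordWeight (Word.equivPair i w).tail := by
  rw [Word.of_smul_def, wordWeight_rcons]
  rfl

theorem wordWeight_eq (i : Fin 2) (w : Word LatticeFactor) :
    wordWeight w = latticeWeight (Word.equivPair i w).head.toAdd *
      wordWeight (Word.equivPair i w).tail := by
  simpa using wordWeight_of_smul (1 : LatticeFactor i) w

/-- The sum of `wordWeight` over the translates of a word by the generators of the `i`-th factor. -/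
def factorSum (i : Fin 2) (w : Word LatticeFactor) : ℝ :=
  neighborSum (Word.equivPair i w).head.toAdd * wordWeight (Word.equivPair i w).tail

theorem factorSum_of_head_eq_one {i : Fin 2} {w : Word LatticeFactor}
    (h : (Word.equivPair i w).head = 1) : factorSum i w = 2 * wordWeight w := by
  rw [wordWeight_eq i w, factorSum, h]
  simp [neighborSum_zero]

theorem factorSum_le (i : Fin 2) (w : Word LatticeFactor) :
    factorSum i w ≤ 17 / 4 * wordWeight w := by
  by_cases h : (Word.equivPair i w).head = 1
  · rw [factorSum_of_head_eq_one h]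
    linarith [wordWeight_pos w]
  · rw [wordWeight_eq i w, factorSum, ← mul_assoc]
    exact mul_le_mul_of_nonneg_right (neighborSum_le (by simpa using h)) (wordWeight_pos _).le

theorem factorSum_add_factorSum_le (w : Word LatticeFactor) :
    factorSum 0 w + factorSum 1 w ≤ 25 / 4 * wordWeight w := by
  by_cases h : w.fstIdx = some 0
  · have h₁ : factorSum 1 w = 2 * wordWeight w := factorSum_of_head_eq_one <| by
      rw [Word.equivPair_eq_of_fstIdx_ne (by simp [h])]
    linarith [factorSum_le 0 w]
  · have h₀ : factorSum 0 w = 2 * wordWeight w := factorSum_of_head_eq_one <| by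
      rw [Word.equivPair_eq_of_fstIdx_ne h]
    linarith [factorSum_le 1 w]

/-- The image in `ℤ² * ℤ²` of a generator of the surface group of genus two. -/
def toFreeProductGen (p : Fin 2 × Bool) : CoprodI LatticeFactor :=
  of (i := p.1) (Multiplicative.ofAdd (if p.2 then ((0, 1) : ℤ × ℤ) else (1, 0)))

/-- The quotient map from the surface group of genus two onto `ℤ² * ℤ²`. -/
def toFreeProduct : SurfaceGroup 2 →* CoprodI LatticeFactor :=
  PresentedGroup.toGroup (f := toFreeProductGen) <| by
    rintro r rfl
    have hc (j : Fin 2) : toFreeProductGen (j, false) * toFreeProductGen (j, true) *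
        (toFreeProductGen (j, false))⁻¹ * (toFreeProductGen (j, true))⁻¹ = 1 := by
      have : Commute (toFreeProductGen (j, false)) (toFreeProductGen (j, true)) :=
        (Commute.all _ _).map of
      rw [this.eq]
      group
    simp [surfaceRel, List.finRange_succ, hc]

theorem toFreeProduct_sgenFun_inv (p : Fin 2 × Bool × Bool) :
    (toFreeProduct (sgenFun 2 p))⁻¹ = of (M := LatticeFactor) (i := p.1) (Multiplicative.ofAdd
      (if p.2.2 then (if p.2.1 then ((0, 1) : ℤ × ℤ) else (1, 0))
        else -(if p.2.1 then ((0, 1) : ℤ × ℤ) else (1, 0)))) := by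
  obtain ⟨j, w, _ | _⟩ := p <;> simp [sgenFun, toFreeProduct, toFreeProductGen, ofAdd_neg]

/-- The positive function on the surface group of genus two used in the Schur test. -/
def surfaceWeight (x : SurfaceGroup 2) : ℝ :=
  wordWeight ((toFreeProduct x)⁻¹ • Word.empty)

theorem sum_surfaceWeight_le (x : SurfaceGroup 2) :
    ∑ p, surfaceWeight (x * sgenFun 2 p) ≤ 25 / 4 * surfaceWeight x := by
  refine le_trans (le_of_eq ?_) (factorSum_add_factorSum_le _)
  simp only [surfaceWeight, map_mul, mul_inv_rev, mul_smul, toFreeProduct_sgenFun_inv,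
    wordWeight_of_smul, Fintype.sum_prod_type, Fin.sum_univ_two, Fintype.sum_bool, factorSum,
    neighborSum, toAdd_ofAdd, if_true, Bool.false_eq_true, if_false, sub_eq_neg_add]
  simp only [add_comm (_ : ℤ × ℤ) (1, 0), add_comm (_ : ℤ × ℤ) (0, 1)]
  ring

/-- Corollary 2: `μ_2 ≤ 0.784`. -/
theorem mu_two_le (M : lp (fun _ : SurfaceGroup 2 => ℂ) 2 →L[ℂ]
      lp (fun _ : SurfaceGroup 2 => ℂ) 2)
    (hM : IsMarkov 2 M) :
    ‖M‖ ≤ 0.784 := by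
  classical
  have hgen (p : Fin 2 × Bool × Bool) : sgenFun 2 (p.1, p.2.1, !p.2.2) = (sgenFun 2 p)⁻¹ := by
    obtain ⟨j, w, _ | _⟩ := p <;> simp [sgenFun]
  let e : Fin 2 × Bool × Bool ≃ Fin 2 × Bool × Bool :=
    (Equiv.refl _).prodCongr ((Equiv.refl _).prodCongr Equiv.boolNot)
  refine M.opNorm_le_bound (by norm_num) fun f => ?_
  refine lp.norm_le_of_forall_sum_le (by norm_num) (by positivity) fun T => ?_
  simp only [ENNReal.toReal_ofNat, Real.rpow_ofNat]
  have hB (T : Finset (SurfaceGroup 2)) : ∑ x ∈ T, ‖f x‖ ^ 2 ≤ ‖f‖ ^ 2 := by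
    simpa using lp.sum_rpow_le_norm_rpow (p := 2) (by norm_num) f T
  have hschur := sum_sq_sum_mul_right_le_s4 (sgenFun 2) e hgen (F := surfaceWeight)
    (fun _ => wordWeight_pos _) (by norm_num) sum_surfaceWeight_le hB T
  have hMx (x : SurfaceGroup 2) : ‖M f x‖ ≤ 1 / 8 * ∑ p, ‖f (x * sgenFun 2 p)‖ := by
    rw [hM f x, norm_mul]
    norm_num
    refine (norm_sum_le _ _).trans ?_
    exact Finset.sum_image_le_of_nonneg fun _ _ => norm_nonneg _
  calc ∑ x ∈ T, ‖M f x‖ ^ 2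
      ≤ ∑ x ∈ T, (1 / 8 * ∑ p, ‖f (x * sgenFun 2 p)‖) ^ 2 := by
        gcongr with x
        exact hMx x
    _ = (1 / 8) ^ 2 * ∑ x ∈ T, (∑ p, ‖f (x * sgenFun 2 p)‖) ^ 2 := by
        rw [Finset.mul_sum]
        exact Finset.sum_congr rfl fun x _ => mul_pow _ _ _
    _ ≤ (1 / 8) ^ 2 * ((25 / 4) ^ 2 * ‖f‖ ^ 2) := by gcongr
    _ ≤ (0.784 * ‖f‖) ^ 2 := by
        rw [mul_pow]
        nlinarith [sq_nonneg ‖f‖]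
end
end
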